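/- arXiv:1908.05345 — 2 statements merged into one kernel-verified Lean document; each statement's English description precedes it below -/
import Mathlib

section
/- Let V be a finite type and let f : V → ℝ assign to each element the left endpoint of a unit interval [f v, f v + 1]. Then there exists an injective function f' : V → ℝ such that for all distinct v, w ∈ V, the unit intervals [f' v, f' v + 1] and [f' w, f' w + 1] intersect if and only if the unit intervals [f v, f v + 1] and [f w, f w + 1] intersect; equivalently, for all distinct v, w: |f' v − f' w| ≤ 1 ↔ |f v − f w| ≤ 1. (Thus every unit interval representation of a graph can be replaced by one in which all interval endpoints are distinct, without changing the intersection graph.) -/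
open Filter Topology in
/-- A finite family of reals can be contracted so that every pairwise distance avoids `1` while
its position relative to `1` is kept, with distance `1` moving below. -/
theorem exists_pos_scaling_abs_sub_lt_one {V : Type*} [Finite V] (f : V → ℝ) :
    ∃ c : ℝ, 0 < c ∧ ∀ v w : V,
      (|f v - f w| ≤ 1 → |c * (f v - f w)| < 1) ∧ (1 < |f v - f w| → 1 < |c * (f v - f w)|) := by
  have hpos : ∀ᶠ c : ℝ in 𝓝[<] 1, 0 < c :=
    nhdsWithin_le_nhds (lt_mem_nhds one_pos)
  have hpair : ∀ᶠ c : ℝ in 𝓝[<] 1, ∀ v w : V,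
      (|f v - f w| ≤ 1 → |c * (f v - f w)| < 1) ∧ (1 < |f v - f w| → 1 < |c * (f v - f w)|) := by
    refine eventually_all.2 fun v => eventually_all.2 fun w => ?_
    rcases le_or_gt |f v - f w| 1 with h | h
    · filter_upwards [hpos, self_mem_nhdsWithin] with c hc hc1
      refine ⟨fun _ => ?_, fun h' => absurd h' h.not_gt⟩
      rw [abs_mul, abs_of_pos hc]
      have : c < 1 := hc1
      nlinarith
    · have hcont : Tendsto (fun c : ℝ => |c * (f v - f w)|) (𝓝 1) (𝓝 |1 * (f v - f w)|) :=
        Continuous.tendsto (by fun_prop) 1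
      filter_upwards [nhdsWithin_le_nhds (hcont.eventually (lt_mem_nhds (by simpa using h)))]
        with c hc
      exact ⟨fun h' => absurd h h'.not_gt, fun _ => hc⟩
  exact (hpos.and hpair).exists

open Filter Topology in
/-- Every unit interval representation `f : V → ℝ` can be replaced by an
injective representation `f'` inducing the same intersection graph. -/
theorem unit_interval_representation_distinct_endpoints
    (V : Type*) [Fintype V] (f : V → ℝ) :
    ∃ f' : V → ℝ, Function.Injective f' ∧
      ∀ v w : V, v ≠ w → (|f' v - f' w| ≤ 1 ↔ |f v - f w| ≤ 1) := by
  obtain ⟨c, hc, hf⟩ := exists_pos_scaling_abs_sub_lt_one f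
  obtain ⟨e, he⟩ : ∃ e : V → ℝ, Function.Injective e :=
    ⟨fun v => (Fintype.equivFin V v : ℕ), fun v w h => by simpa [Fin.val_inj] using h⟩
  have hlim (v w : V) : Tendsto (fun ε : ℝ => (c * f v + ε * e v) - (c * f w + ε * e w))
      (𝓝[>] 0) (𝓝 (c * (f v - f w))) := by
    refine tendsto_nhdsWithin_of_tendsto_nhds ?_
    refine Continuous.tendsto' (by fun_prop) _ _ ?_
    ring
  have hev : ∀ᶠ ε : ℝ in 𝓝[>] 0, ∀ v w : V, v ≠ w →
      (c * f v + ε * e v) ≠ (c * f w + ε * e w) ∧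
      (|(c * f v + ε * e v) - (c * f w + ε * e w)| ≤ 1 ↔ |f v - f w| ≤ 1) := by
    refine eventually_all.2 fun v => eventually_all.2 fun w => ?_
    suffices (∀ᶠ ε : ℝ in 𝓝[>] 0, v ≠ w → (c * f v + ε * e v) ≠ (c * f w + ε * e w)) ∧
        ∀ᶠ ε : ℝ in 𝓝[>] 0,
          (|(c * f v + ε * e v) - (c * f w + ε * e w)| ≤ 1 ↔ |f v - f w| ≤ 1) from
      (this.1.and this.2).mono fun ε h hvw => ⟨h.1 hvw, h.2⟩
    constructor
    · by_cases h : f v = f w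
      · filter_upwards [self_mem_nhdsWithin] with ε hε hvw
        have hε' : ε ≠ 0 := ne_of_gt hε
        simpa [h, hε'] using he.ne hvw
      · filter_upwards [(hlim v w).eventually_ne (mul_ne_zero hc.ne' (sub_ne_zero.2 h))]
          with ε hε _
        exact sub_ne_zero.1 hε
    · rcases le_or_gt |f v - f w| 1 with h | h
      · filter_upwards [(hlim v w).abs.eventually (gt_mem_nhds ((hf v w).1 h))] with ε hε
        exact iff_of_true hε.le h
      · filter_upwards [(hlim v w).abs.eventually (lt_mem_nhds ((hf v w).2 h))] with ε hε
        exact iff_of_false hε.not_ge h.not_ge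
  obtain ⟨ε, hε⟩ := hev.exists
  exact ⟨fun v => c * f v + ε * e v, fun v w h => by_contra fun hvw => (hε v w hvw).1 h,
    fun v w hvw => (hε v w hvw).2⟩
end

section
/- Let H be a simple graph on a finite vertex set V of clique-width at most k, where k ≥ 2, let V1 and V2 be disjoint subsets of V, and let s ∈ V \ (V1 ∪ V2). Then there exists a (3k+1)-expression defining H such that in the labeled graph produced by this expression, all vertices in V1 receive label 1, all vertices in V2 receive label 2, s receives label 3, and all remaining vertices receive label 4. -/
/-- A `k`-expression (with natural-number labels): terms built from single labeled
vertices `i(v)` by disjoint union `⊕`, relabeling `p_{i→j}` and edge insertion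
`η_{i,j}`. -/
inductive CWExpr (V : Type*) : Type _
  | single (v : V) (i : ℕ) : CWExpr V
  | union (a b : CWExpr V) : CWExpr V
  | relabel (i j : ℕ) (a : CWExpr V) : CWExpr V
  | addEdges (i j : ℕ) (a : CWExpr V) : CWExpr V

variable {V : Type*} [DecidableEq V]

/-- The set of vertices of the labeled graph produced by an expression. -/
def CWExpr.support : CWExpr V → Finset V
  | .single v _ => {v}
  | .union a b => a.support ∪ b.support
  | .relabel _ _ a => a.support
  | .addEdges _ _ a => a.support

/-- The labeling of the labeled graph produced by an expression. -/
def CWExpr.label : CWExpr V → V → ℕ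
  | .single _ i => fun _ => i
  | .union a b => fun w => if w ∈ a.support then a.label w else b.label w
  | .relabel i j a => fun w => if a.label w = i then j else a.label w
  | .addEdges _ _ a => a.label

/-- The adjacency relation of the labeled graph produced by an expression. -/
def CWExpr.adj : CWExpr V → V → V → Prop
  | .single _ _ => fun _ _ => False
  | .union a b => fun u w => a.adj u w ∨ b.adj u w
  | .relabel _ _ a => a.adj
  | .addEdges i j a => fun u w =>
      a.adj u w ∨ (u ≠ w ∧ u ∈ a.support ∧ w ∈ a.support ∧
        ((a.label u = i ∧ a.label w = j) ∨ (a.label u = j ∧ a.label w = i)))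

/-- Well-formedness of a `k`-expression: all labels lie in `{1, …, k}`, the two sides
of each disjoint union have disjoint vertex sets (so every vertex is introduced exactly
once), and edges are only inserted between distinct labels. -/
def CWExpr.Wf (k : ℕ) : CWExpr V → Prop
  | .single _ i => 1 ≤ i ∧ i ≤ k
  | .union a b => a.Wf k ∧ b.Wf k ∧ Disjoint a.support b.support
  | .relabel i j a => 1 ≤ i ∧ i ≤ k ∧ 1 ≤ j ∧ j ≤ k ∧ a.Wf k
  | .addEdges i j a => i ≠ j ∧ 1 ≤ i ∧ i ≤ k ∧ 1 ≤ j ∧ j ≤ k ∧ a.Wf k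

/-- An expression defines a simple graph `H` on the whole vertex type `V` if its
produced labeled graph has vertex set `V` and the same adjacency as `H`. -/
def CWExpr.Defines [Fintype V] (e : CWExpr V) (H : SimpleGraph V) : Prop :=
  e.support = Finset.univ ∧ ∀ u w : V, e.adj u w ↔ H.Adj u w

namespace CWExpr

theorem Wf.label_mem {k : ℕ} {e : CWExpr V} (h : e.Wf k) (v : V) :
    1 ≤ e.label v ∧ e.label v ≤ k := by
  induction e with
  | single w i => exact h
  | union a b iha ihb =>
    have := iha h.1
    have := ihb h.2.1
    simp only [label]
    split_ifs <;> assumption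
  | relabel i j a ih =>
    obtain ⟨-, -, hj, hj', ha⟩ := h
    have := ih ha
    simp only [label]
    split_ifs <;> omega
  | addEdges i j a ih => exact ih h.2.2.2.2.2

/-- Insert the edges between all pairs of labels in a list. -/
def addEdgesList (L : List (ℕ × ℕ)) (e : CWExpr V) : CWExpr V :=
  L.foldr (fun p a => .addEdges p.1 p.2 a) e

@[simp]
theorem support_addEdgesList (L : List (ℕ × ℕ)) (e : CWExpr V) :
    (e.addEdgesList L).support = e.support := by
  induction L with
  | nil => rfl
  | cons p L ih => exact ih

@[simp]
theorem label_addEdgesList (L : List (ℕ × ℕ)) (e : CWExpr V) :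
    (e.addEdgesList L).label = e.label := by
  induction L with
  | nil => rfl
  | cons p L ih => exact ih

theorem Wf.addEdgesList {k : ℕ} {e : CWExpr V} (h : e.Wf k) {L : List (ℕ × ℕ)}
    (hL : ∀ p ∈ L, p.1 ≠ p.2 ∧ 1 ≤ p.1 ∧ p.1 ≤ k ∧ 1 ≤ p.2 ∧ p.2 ≤ k) :
    (e.addEdgesList L).Wf k := by
  induction L with
  | nil => exact h
  | cons p L ih =>
    obtain ⟨h₁, h₂, h₃, h₄, h₅⟩ := hL p (by simp)
    exact ⟨h₁, h₂, h₃, h₄, h₅, ih fun q hq => hL q (by simp [hq])⟩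

theorem adj_addEdgesList (L : List (ℕ × ℕ)) (e : CWExpr V) (u w : V) :
    (e.addEdgesList L).adj u w ↔ e.adj u w ∨ (u ≠ w ∧ u ∈ e.support ∧ w ∈ e.support ∧
      ∃ p ∈ L, (e.label u = p.1 ∧ e.label w = p.2) ∨ (e.label u = p.2 ∧ e.label w = p.1)) := by
  induction L with
  | nil => simp [addEdgesList]
  | cons p L ih =>
    change ((e.addEdgesList L).adj u w ∨ (u ≠ w ∧ u ∈ (e.addEdgesList L).support ∧
      w ∈ (e.addEdgesList L).support ∧ (((e.addEdgesList L).label u = p.1 ∧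
      (e.addEdgesList L).label w = p.2) ∨ ((e.addEdgesList L).label u = p.2 ∧
      (e.addEdgesList L).label w = p.1)))) ↔ _
    rw [ih, support_addEdgesList, label_addEdgesList]
    rw [List.exists_mem_cons_iff, or_assoc, ← and_or_left, ← and_or_left, ← and_or_left]
    simp only [or_comm]

/-- The code of label `i` for vertices of class `c`, where the classes are `1`, `2` and `3`.
The code `3` is not used; label `1` has codes `1`, `2`, `4`. -/
def classCode (c i : ℕ) : ℕ :=
  if i = 1 then (if c = 3 then 4 else c) else 3 * i + c - 2

/-- The code of a vertex `v` labeled `i`: the vertex `s` gets the code `3`, which it shares with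
no other vertex. -/
def vertexCode (s : V) (c : V → ℕ) (v : V) (i : ℕ) : ℕ :=
  if v = s then 3 else classCode (c v) i

theorem classCode_mem {k c i : ℕ} (hk : 2 ≤ k) (hc : 1 ≤ c ∧ c ≤ 3) (hi : 1 ≤ i ∧ i ≤ k) :
    1 ≤ classCode c i ∧ classCode c i ≤ 3 * k + 1 := by
  unfold classCode
  split_ifs <;> omega

theorem classCode_ne_three {c i : ℕ} (hc : 1 ≤ c ∧ c ≤ 3) :
    classCode c i ≠ 3 := by
  unfold classCode
  split_ifs <;> omega

theorem classCode_inj {c d i j : ℕ} (hc : 1 ≤ c ∧ c ≤ 3) (hd : 1 ≤ d ∧ d ≤ 3)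
    (hi : 1 ≤ i) (hj : 1 ≤ j) : classCode c i = classCode d j ↔ c = d ∧ i = j := by
  unfold classCode
  split_ifs <;> omega

/-- Splitting every label according to a partition of the vertices into three classes and an
isolated vertex `s`, which keeps its own label throughout. -/
theorem exists_vertexCode {k : ℕ} (hk : 2 ≤ k) (s : V) (c : V → ℕ)
    (hc : ∀ v, 1 ≤ c v ∧ c v ≤ 3) (e : CWExpr V) (he : e.Wf k) :
    ∃ e' : CWExpr V, e'.Wf (3 * k + 1) ∧ e'.support = e.support ∧
      (∀ u w, e'.adj u w ↔ e.adj u w) ∧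
      ∀ v ∈ e.support, e'.label v = vertexCode s c v (e.label v) := by
  have code_mem : ∀ v i, 1 ≤ i ∧ i ≤ k →
      1 ≤ vertexCode s c v i ∧ vertexCode s c v i ≤ 3 * k + 1 := by
    intro v i hi
    unfold vertexCode
    split_ifs
    · omega
    · exact classCode_mem hk (hc v) hi
  induction e with
  | single v i =>
    refine ⟨.single v (vertexCode s c v i), code_mem v i he, rfl, fun _ _ => Iff.rfl, ?_⟩
    simp [support, label]
  | union a b iha ihb =>
    obtain ⟨ha, hb, hab⟩ := he
    obtain ⟨a', wa, sa, ja, la⟩ := iha ha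
    obtain ⟨b', wb, sb, jb, lb⟩ := ihb hb
    refine ⟨.union a' b', ⟨wa, wb, by rwa [sa, sb]⟩, by simp [support, sa, sb],
      by simp [adj, ja, jb], ?_⟩
    intro v hv
    simp only [label, sa]
    simp only [support, Finset.mem_union] at hv
    split_ifs with h
    · exact la v h
    · exact lb v (hv.resolve_left h)
  | relabel i j a ih =>
    obtain ⟨hi, hi', hj, hj', ha⟩ := he
    obtain ⟨a', wa, sa, ja, la⟩ := ih ha
    have m (d l : ℕ) (hd : 1 ≤ d ∧ d ≤ 3) (hl : 1 ≤ l ∧ l ≤ k) := classCode_mem hk hd hl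
    have mi (d : ℕ) (hd : 1 ≤ d ∧ d ≤ 3) := m d i hd ⟨hi, hi'⟩
    have mj (d : ℕ) (hd : 1 ≤ d ∧ d ≤ 3) := m d j hd ⟨hj, hj'⟩
    refine ⟨.relabel (classCode 1 i) (classCode 1 j) (.relabel (classCode 2 i) (classCode 2 j)
      (.relabel (classCode 3 i) (classCode 3 j) a')), ?_, sa, ja, ?_⟩
    · exact ⟨(mi 1 (by simp)).1, (mi 1 (by simp)).2, (mj 1 (by simp)).1, (mj 1 (by simp)).2,
        (mi 2 (by simp)).1, (mi 2 (by simp)).2, (mj 2 (by simp)).1, (mj 2 (by simp)).2,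
        (mi 3 (by simp)).1, (mi 3 (by simp)).2, (mj 3 (by simp)).1, (mj 3 (by simp)).2, wa⟩
    · intro v hv
      have hl := (ha.label_mem v).1
      have hcv := hc v
      simp only [label, la v hv, vertexCode]
      by_cases hvs : v = s
      · have n (d : ℕ) (hd : 1 ≤ d ∧ d ≤ 3) := (classCode_ne_three (i := i) hd).symm
        simp [hvs, n 1 (by simp), n 2 (by simp), n 3 (by simp)]
      · simp only [hvs, if_false]
        obtain h | h | h : c v = 1 ∨ c v = 2 ∨ c v = 3 := by omega
        all_goals
          by_cases h' : a.label v = i <;> simp [h, h', classCode_inj, hi, hj, hl]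
  | addEdges i j a ih =>
    obtain ⟨hij, hi, hi', hj, hj', ha⟩ := he
    obtain ⟨a', wa, sa, ja, la⟩ := ih ha
    have code_inj : ∀ u w, vertexCode s c u (a.label u) = vertexCode s c w (a.label w) →
        a.label u = a.label w := by
      intro u w h
      have hu := (ha.label_mem u).1
      have hw := (ha.label_mem w).1
      unfold vertexCode at h
      split_ifs at h with h₁ h₂ h₂
      · rw [h₁, h₂]
      · exact absurd h.symm (classCode_ne_three (hc w))
      · exact absurd h (classCode_ne_three (hc u))
      · exact ((classCode_inj (hc u) (hc w) hu hw).1 h).2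
    let code : V → ℕ := fun v => vertexCode s c v (a.label v)
    let L : List (ℕ × ℕ) := ((a.support.filter (a.label · = i)) ×ˢ
      (a.support.filter (a.label · = j))).toList.map (Prod.map code code)
    have hL : ∀ p, p ∈ L ↔ ∃ u ∈ a.support, ∃ w ∈ a.support,
        a.label u = i ∧ a.label w = j ∧ p = (code u, code w) := by
      intro p
      simp only [L, List.mem_map, Finset.mem_toList, Finset.mem_product, Finset.mem_filter,
        Prod.exists, Prod.map_apply]
      grind
    refine ⟨a'.addEdgesList L, wa.addEdgesList ?_, by simpa [support] using sa, ?_,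
      by simpa [support, label] using la⟩
    · intro p hp
      obtain ⟨u, -, w, -, hu, hw, rfl⟩ := (hL p).1 hp
      refine ⟨fun h => hij ?_, ?_⟩
      · rw [← hu, ← hw]
        exact code_inj u w h
      · obtain ⟨h₁, h₂⟩ := code_mem u _ (ha.label_mem u)
        exact ⟨h₁, h₂, code_mem w _ (ha.label_mem w)⟩
    · intro u w
      rw [adj_addEdgesList, ja, sa]
      refine or_congr_right (and_congr_right fun _ => and_congr_right fun hu =>
        and_congr_right fun hw => ?_)
      rw [la u hu, la w hw]
      constructor
      · rintro ⟨p, hp, h⟩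
        obtain ⟨x, -, y, -, hx, hy, rfl⟩ := (hL p).1 hp
        subst hx hy
        exact h.imp (fun h => ⟨code_inj _ _ h.1, code_inj _ _ h.2⟩)
          (fun h => ⟨code_inj _ _ h.1, code_inj _ _ h.2⟩)
      · rintro (⟨h₁, h₂⟩ | ⟨h₁, h₂⟩)
        · exact ⟨_, (hL _).2 ⟨u, hu, w, hw, h₁, h₂, rfl⟩, .inl ⟨rfl, rfl⟩⟩
        · exact ⟨_, (hL _).2 ⟨w, hw, u, hu, h₂, h₁, rfl⟩, .inr ⟨rfl, rfl⟩⟩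

theorem exists_label_eq_one {k : ℕ} {e : CWExpr V} (he : e.Wf k) :
    ∃ e' : CWExpr V, e'.Wf k ∧ e'.support = e.support ∧ e'.adj = e.adj ∧
      ∀ v, e'.label v = 1 := by
  suffices h : ∀ n ≤ k, ∃ e' : CWExpr V, e'.Wf k ∧ e'.support = e.support ∧ e'.adj = e.adj ∧
      ∀ v, e'.label v = 1 ∨ n < e'.label v by
    obtain ⟨e', hw, hs, ha, hl⟩ := h k le_rfl
    exact ⟨e', hw, hs, ha, fun v => (hl v).resolve_right (hw.label_mem v).2.not_gt⟩
  intro n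
  induction n with
  | zero => exact fun _ => ⟨e, he, rfl, rfl, fun v => .inr (he.label_mem v).1⟩
  | succ n ih =>
    intro hn
    obtain ⟨e', hw, hs, ha, hl⟩ := ih (by omega)
    refine ⟨.relabel (n + 1) 1 e', ⟨by omega, hn, le_rfl, by omega, hw⟩, hs, ha, fun v => ?_⟩
    have := hl v
    simp only [label]
    split_ifs <;> omega

end CWExpr

/-- if a graph `H` has clique-width at most `k ≥ 2`, then for any two
disjoint vertex sets `V1, V2` and a vertex `s` outside them, there is a
`(3k+1)`-expression defining `H` whose final labeling gives label `1` to `V1`, label `2`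
to `V2`, label `3` to `s`, and label `4` to all remaining vertices. -/
theorem cliquewidth_relabeling
    (V : Type*) [Fintype V] [DecidableEq V] (k : ℕ) (hk : 2 ≤ k)
    (H : SimpleGraph V) (hH : ∃ e : CWExpr V, e.Wf k ∧ e.Defines H)
    (V1 V2 : Finset V) (hdisj : Disjoint V1 V2)
    (s : V) (hs1 : s ∉ V1) (hs2 : s ∉ V2) :
    ∃ e : CWExpr V, e.Wf (3 * k + 1) ∧ e.Defines H ∧
      (∀ v ∈ V1, e.label v = 1) ∧ (∀ v ∈ V2, e.label v = 2) ∧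
      e.label s = 3 ∧
      (∀ v : V, v ∉ V1 → v ∉ V2 → v ≠ s → e.label v = 4) := by
  obtain ⟨e, he, hes, hea⟩ := hH
  obtain ⟨e₁, hw₁, hs₁, ha₁, hl₁⟩ := CWExpr.exists_label_eq_one he
  let c : V → ℕ := fun v => if v ∈ V1 then 1 else if v ∈ V2 then 2 else 3
  have hc : ∀ v, 1 ≤ c v ∧ c v ≤ 3 := by
    intro v
    simp only [c]
    split_ifs <;> omega
  obtain ⟨e₂, hw₂, hs₂, ha₂, hl₂⟩ := CWExpr.exists_vertexCode hk s c hc e₁ hw₁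
  have hl : ∀ v, e₂.label v = if v = s then 3 else if c v = 3 then 4 else c v := by
    intro v
    rw [hl₂ v (by simp [hs₁, hes]), hl₁ v]
    simp [CWExpr.vertexCode, CWExpr.classCode]
  refine ⟨e₂, hw₂, ⟨by rw [hs₂, hs₁, hes], fun u w => by rw [ha₂, ha₁, hea]⟩, ?_, ?_, ?_, ?_⟩
  · intro v hv
    have : v ≠ s := fun h => hs1 (h ▸ hv)
    simp [hl, c, hv, this]
  · intro v hv
    have : v ≠ s := fun h => hs2 (h ▸ hv)
    have h1 : v ∉ V1 := Finset.disjoint_right.1 hdisj hv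
    simp [hl, c, hv, this, h1]
  · simp [hl]
  · intro v h1 h2 hvs
    simp [hl, c, h1, h2, hvs]
end
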